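/- arXiv:math/0510617 — 7 statements merged into one kernel-verified Lean document; each statement's English description precedes it below -/
import Mathlib

section
/- Let C > 0, ε > 0 and q > 0 satisfy (C/ε) q^{−ε} < 1. Let T : [q, ∞) → ℝ be continuous with 0 ≤ T(r) ≤ C r^{−(2+ε)} for all r ≥ q, and let g : [q, ∞) → ℝ be twice differentiable with g''(r) = −T(r) g(r) for all r ≥ q, g(q) = 0 and g'(q) = 1. Then g(r) > 0 for all r > q; in particular g has no zero in (q, ∞). -/
/-- If the derivative of `g` is positive on `[q, c)`, and `g` solves `g'' = -T g` with `g q = 0` and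
`g' q = 1`, then the derivative is still positive at `c`. -/
theorem deriv_pos_of_deriv_pos_on_Ico {C ε q c : ℝ} (hε : 0 < ε) (hq : 0 < q)
    (hsmall : C / ε * q ^ (-ε) < 1) (hC : 0 < C) (hc : q ≤ c) {T g g' g'' : ℝ → ℝ}
    (hT : ∀ r ∈ Set.Ici q, 0 ≤ T r ∧ T r ≤ C * r ^ (-(2 + ε)))
    (hg : ∀ r ∈ Set.Ici q, HasDerivWithinAt g (g' r) (Set.Ici q) r)
    (hg' : ∀ r ∈ Set.Ici q, HasDerivWithinAt g' (g'' r) (Set.Ici q) r)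
    (hode : ∀ r ∈ Set.Ici q, g'' r = -(T r) * g r)
    (hgq : g q = 0) (hg'q : g' q = 1) (hpos : ∀ r ∈ Set.Ico q c, 0 < g' r) : 0 < g' c := by
  have hIcc : Set.Icc q c ⊆ Set.Ici q := Set.Icc_subset_Ici_self
  have hint : interior (Set.Icc q c) ⊆ Set.Icc q c := interior_subset
  have hgc : ContinuousOn g (Set.Icc q c) := fun r hr ↦
    ((hg r (hIcc hr)).mono hIcc).continuousWithinAt
  have hg'c : ContinuousOn g' (Set.Icc q c) := fun r hr ↦
    ((hg' r (hIcc hr)).mono hIcc).continuousWithinAt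
  have hqmem : q ∈ Set.Icc q c := Set.left_mem_Icc.2 hc
  have hcmem : c ∈ Set.Icc q c := Set.right_mem_Icc.2 hc
  have hmono : MonotoneOn g (Set.Icc q c) := by
    refine monotoneOn_of_hasDerivWithinAt_nonneg (f' := g') (convex_Icc q c) hgc
      (fun r hr ↦ (hg r (hIcc (hint hr))).mono (hint.trans hIcc)) fun r hr ↦ ?_
    rw [interior_Icc] at hr
    exact (hpos r ⟨hr.1.le, hr.2⟩).le
  have hnonneg : ∀ r ∈ Set.Icc q c, 0 ≤ g r := fun r hr ↦ hgq ▸ hmono hqmem hr hr.1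
  have hanti : AntitoneOn g' (Set.Icc q c) := by
    refine antitoneOn_of_hasDerivWithinAt_nonpos (f' := g'') (convex_Icc q c) hg'c
      (fun r hr ↦ (hg' r (hIcc (hint hr))).mono (hint.trans hIcc)) fun r hr ↦ ?_
    rw [hode r (hIcc (hint hr)), neg_mul]
    exact neg_nonpos.2 (mul_nonneg (hT r (hIcc (hint hr))).1 (hnonneg r (hint hr)))
  have hle : ∀ r ∈ Set.Icc q c, g r ≤ r := by
    have hsub : AntitoneOn (fun r ↦ g r - r) (Set.Icc q c) := by
      refine antitoneOn_of_hasDerivWithinAt_nonpos (f' := fun r ↦ g' r - 1) (convex_Icc q c)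
        (hgc.sub continuousOn_id)
        (fun r hr ↦ ((hg r (hIcc (hint hr))).mono (hint.trans hIcc)).sub
          (hasDerivWithinAt_id r _)) fun r hr ↦ ?_
      have := hanti hqmem (hint hr) (hint hr).1
      linarith
    intro r hr
    have : g r - r ≤ g q - q := hsub hqmem hr hr.1
    linarith
  have hφ : ∀ r ∈ Set.Icc q c, HasDerivWithinAt (fun r ↦ g' r - C / ε * r ^ (-ε))
      (g'' r - C / ε * (-ε * r ^ (-ε - 1))) (Set.Icc q c) r := fun r hr ↦
    ((hg' r (hIcc hr)).mono hIcc).sub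
      ((Real.hasDerivAt_rpow_const (Or.inl (hq.trans_le hr.1).ne')).const_mul
        (C / ε)).hasDerivWithinAt
  have hφmono : MonotoneOn (fun r ↦ g' r - C / ε * r ^ (-ε)) (Set.Icc q c) := by
    refine monotoneOn_of_hasDerivWithinAt_nonneg (convex_Icc q c)
      (fun r hr ↦ (hφ r hr).continuousWithinAt)
      (fun r hr ↦ (hφ r (hint hr)).mono hint) fun r hr ↦ ?_
    have hr' := hint hr
    have hr0 : 0 < r := hq.trans_le hr'.1
    have hTg : T r * g r ≤ C * r ^ (-(2 + ε)) * r :=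
      mul_le_mul (hT r (hIcc hr')).2 (hle r hr') (hnonneg r hr') (by positivity)
    have hpow : r ^ (-ε - 1) = r ^ (-(2 + ε)) * r := by
      rw [← Real.rpow_add_one hr0.ne']
      congr 1
      ring
    have hcancel : C / ε * (-ε * r ^ (-ε - 1)) = -(C * r ^ (-(2 + ε)) * r) := by
      rw [hpow]
      field_simp
    rw [hode r (hIcc hr'), hcancel]
    linarith
  have hend : g' q - C / ε * q ^ (-ε) ≤ g' c - C / ε * c ^ (-ε) := hφmono hqmem hcmem hc
  have : 0 < C / ε * c ^ (-ε) := by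
    have := hq.trans_le hc
    positivity
  linarith

/-- If `0 ≤ T(r) ≤ C r^{−(2+ε)}` on `[q, ∞)` with `(C/ε) q^{−ε} < 1`, and `g'' = −T g`
with `g(q) = 0`, `g'(q) = 1`, then `g > 0` on `(q, ∞)`. -/
theorem no_further_zero_of_decaying_potential
    (C ε q : ℝ) (hC : 0 < C) (hε : 0 < ε) (hq : 0 < q)
    (hsmall : C / ε * q ^ (-ε) < 1)
    (T : ℝ → ℝ) (hTcont : ContinuousOn T (Set.Ici q))
    (hT : ∀ r ∈ Set.Ici q, 0 ≤ T r ∧ T r ≤ C * r ^ (-(2 + ε)))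
    (g g' g'' : ℝ → ℝ)
    (hg : ∀ r ∈ Set.Ici q, HasDerivWithinAt g (g' r) (Set.Ici q) r)
    (hg' : ∀ r ∈ Set.Ici q, HasDerivWithinAt g' (g'' r) (Set.Ici q) r)
    (hode : ∀ r ∈ Set.Ici q, g'' r = -(T r) * g r)
    (hgq : g q = 0) (hg'q : g' q = 1) :
    ∀ r, q < r → 0 < g r := by
  have hcont : ContinuousOn g' (Set.Ici q) := fun r hr ↦ (hg' r hr).continuousWithinAt
  have hg'pos : ∀ r ∈ Set.Ici q, 0 < g' r := by
    by_contra! h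
    obtain ⟨b, hb, hgb⟩ := h
    have hcompact : IsCompact (Set.Icc q b ∩ g' ⁻¹' Set.Iic 0) :=
      isCompact_Icc.of_isClosed_subset
        ((hcont.mono Set.Icc_subset_Ici_self).preimage_isClosed_of_isClosed isClosed_Icc
          isClosed_Iic) Set.inter_subset_left
    obtain ⟨c, ⟨hcmem, hgc⟩, hleast⟩ := hcompact.exists_isLeast ⟨b, ⟨hb, le_rfl⟩, hgb⟩
    refine (deriv_pos_of_deriv_pos_on_Ico hε hq hsmall hC hcmem.1 hT hg hg' hode hgq hg'q
      fun r hr ↦ ?_).not_ge hgc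
    by_contra! hr0
    exact (hleast ⟨⟨hr.1, hr.2.le.trans hcmem.2⟩, hr0⟩).not_gt hr.2
  have hstrict : StrictMonoOn g (Set.Ici q) :=
    strictMonoOn_of_hasDerivWithinAt_pos (convex_Ici q)
      (fun r hr ↦ (hg r hr).continuousWithinAt)
      (fun r hr ↦ (hg r (interior_subset hr)).mono interior_subset)
      fun r hr ↦ hg'pos r (interior_subset hr)
  intro r hr
  exact hgq ▸ hstrict Set.self_mem_Ici hr.le hr
end

section
/- Let R > 0, M ≥ 0, and let Q : [0, R] → ℝ be continuous with ∫₀^R |Q(r) − 1| dr ≤ M. Let f be a twice continuously differentiable real-valued solution of f''(r) + Q(r) f(r) = 0 on [0, R] that is not identically zero. Then the zero set Z = {r ∈ [0, R] : f(r) = 0} is finite, and its cardinality N satisfies |N − R/π| ≤ M/π + 2. -/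
open Set Filter Topology

/-- A function whose derivative is positive wherever it takes the value `c` crosses the level `c`
only upwards. -/
theorem lt_of_le_of_deriv_pos_on_level {φ p : ℝ → ℝ} (hφ : ∀ x, HasDerivAt φ (p x) x)
    {c s t : ℝ} (hst : s < t) (hp : ∀ x ∈ Icc s t, φ x = c → 0 < p x) (hs : c ≤ φ s) :
    c < φ t := by
  have hle : ∀ ⦃x⦄, x ∈ Icc s t → c ≤ φ x :=
    image_le_of_deriv_right_lt_deriv_boundary (f := fun _ => c) (f' := fun _ => 0)
      continuousOn_const (fun x _ => hasDerivWithinAt_const x _ c) hs hφ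
      (fun x hx h => hp x (Ico_subset_Icc_self hx) h.symm)
  refine lt_of_le_of_ne (hle (right_mem_Icc.2 hst.le)) fun hc => ?_
  have hpos := hp t (right_mem_Icc.2 hst.le) hc.symm
  have hslope := (hasDerivWithinAt_iff_tendsto_slope' (s := Iio t) (by simp)).1
    (hφ t).hasDerivWithinAt
  have hev := (hslope.eventually (lt_mem_nhds hpos)).and (Ico_mem_nhdsLT hst)
  obtain ⟨x, hx, hxs, hxt⟩ := hev.exists
  rw [slope_def_field] at hx
  have := hle ⟨hxs, hxt.le⟩
  exact hx.not_ge (div_nonpos_of_nonneg_of_nonpos (by linarith) (by linarith))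

/-- If an angle function increases through every multiple of `π`, then the number of times it meets
`ℤ π` differs from its total variation divided by `π` by at most one. -/
theorem finite_and_ncard_sin_eq_zero {φ p : ℝ → ℝ} (hφ : ∀ x, HasDerivAt φ (p x) x)
    {R : ℝ} (hR : 0 < R) (hp : ∀ x ∈ Icc 0 R, Real.sin (φ x) = 0 → 0 < p x) :
    {x ∈ Icc 0 R | Real.sin (φ x) = 0}.Finite ∧
      |({x ∈ Icc 0 R | Real.sin (φ x) = 0}.ncard : ℝ) - (φ R - φ 0) / Real.pi| ≤ 1 := by
  have hπ := Real.pi_pos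
  have hcross : ∀ {s t : ℝ}, 0 ≤ s → s < t → t ≤ R → ∀ k : ℤ, k * Real.pi ≤ φ s →
      k * Real.pi < φ t := fun h0 hst hR k hk =>
    lt_of_le_of_deriv_pos_on_level hφ hst (fun x hx hxk =>
      hp x ⟨h0.trans hx.1, hx.2.trans hR⟩ (by rw [hxk, Real.sin_int_mul_pi])) hk
  have hcont : Continuous φ := continuous_iff_continuousAt.2 fun x => (hφ x).continuousAt
  set a := φ 0 / Real.pi with ha
  set b := φ R / Real.pi with hb
  set I : Finset ℤ := Finset.Icc ⌈a⌉ ⌊b⌋ with hI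
  have hmemI : ∀ k : ℤ, k ∈ I ↔ φ 0 ≤ k * Real.pi ∧ k * Real.pi ≤ φ R := fun k => by
    rw [hI, Finset.mem_Icc, Int.ceil_le, Int.le_floor, ha, hb, div_le_iff₀ hπ, le_div_iff₀ hπ]
  set Z := {x ∈ Icc 0 R | Real.sin (φ x) = 0} with hZ
  have hinj : InjOn φ Z := by
    have key : ∀ x ∈ Z, ∀ y ∈ Z, x < y → φ x ≠ φ y := fun x hx y hy hxy h => by
      obtain ⟨k, hk⟩ := Real.sin_eq_zero_iff.1 hx.2
      have := hcross hx.1.1 hxy hy.1.2 k hk.le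
      linarith
    intro x hx y hy h
    rcases lt_trichotomy x y with hxy | hxy | hxy
    · exact absurd h (key x hx y hy hxy)
    · exact hxy
    · exact absurd h.symm (key y hy x hx hxy)
  have himg : φ '' Z = (fun k : ℤ => (k : ℝ) * Real.pi) '' (I : Set ℤ) := by
    ext y
    constructor
    · rintro ⟨x, hx, rfl⟩
      obtain ⟨k, hk⟩ := Real.sin_eq_zero_iff.1 hx.2
      refine ⟨k, (hmemI k).2 ⟨?_, ?_⟩, hk⟩
      · by_contra! h
        rcases hx.1.1.eq_or_lt with h0 | h0
        · rw [h0, hk] at h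
          exact lt_irrefl _ h
        · have := hcross le_rfl h0 hx.1.2 k h.le
          linarith
      · rcases hx.1.2.eq_or_lt with h0 | h0
        · rw [hk, h0]
        · exact (hcross hx.1.1 h0 le_rfl k hk.le).le
    · rintro ⟨k, hk, rfl⟩
      obtain ⟨x, hx, hxk⟩ := intermediate_value_Icc hR.le hcont.continuousOn ((hmemI k).1 hk)
      refine ⟨x, ⟨hx, ?_⟩, hxk⟩
      rw [hxk, Real.sin_int_mul_pi]
  have hmulinj : Function.Injective fun k : ℤ => (k : ℝ) * Real.pi := fun k l h =>
    Int.cast_injective (mul_right_cancel₀ hπ.ne' h)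
  have hfin : Z.Finite := .of_finite_image (himg ▸ I.finite_toSet.image _) hinj
  refine ⟨hfin, ?_⟩
  have hcard : Z.ncard = (⌊b⌋ + 1 - ⌈a⌉).toNat := by
    rw [← hinj.ncard_image, himg, ncard_image_of_injective _ hmulinj,
      ncard_coe_finset, hI, Int.card_Icc]
  have hfloor : ⌊a⌋ ≤ ⌊b⌋ := by
    rw [Int.le_floor, hb, le_div_iff₀ hπ]
    refine (hcross le_rfl hR le_rfl _ ?_).le
    rw [← le_div_iff₀ hπ]
    exact Int.floor_le a
  have hnonneg : 0 ≤ ⌊b⌋ + 1 - ⌈a⌉ := by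
    have := Int.ceil_le_floor_add_one a
    omega
  have hcast : (Z.ncard : ℝ) = ⌊b⌋ + 1 - ⌈a⌉ := by
    rw [hcard]
    exact_mod_cast congrArg (Int.cast (R := ℝ)) (Int.toNat_of_nonneg hnonneg)
  rw [hcast, sub_div, ← ha, ← hb, abs_le]
  constructor <;> linarith [Int.floor_le b, Int.lt_floor_add_one b, Int.le_ceil a,
    Int.ceil_lt_add_one a]

/-- A nonnegative function on `[0, R]` with `|E'| ≤ K E` which is positive somewhere is positive
everywhere. -/
theorem pos_of_abs_deriv_le {R K : ℝ} {E E' : ℝ → ℝ}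
    (hE : ∀ r ∈ Icc 0 R, HasDerivWithinAt E (E' r) (Icc 0 R) r)
    (hbound : ∀ r ∈ Icc 0 R, |E' r| ≤ K * E r)
    {r₀ : ℝ} (hr₀ : r₀ ∈ Icc 0 R) (hpos : 0 < E r₀) :
    ∀ r ∈ Icc 0 R, 0 < E r := by
  have hexp : ∀ c r : ℝ, HasDerivAt (fun x => Real.exp (c * x)) (Real.exp (c * r) * c) r :=
    fun c r => by simpa using ((hasDerivAt_id r).const_mul c).exp
  have hd : ∀ c : ℝ, ∀ r ∈ Icc 0 R, HasDerivWithinAt (fun x => E x * Real.exp (c * x))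
      (E' r * Real.exp (c * r) + E r * (Real.exp (c * r) * c)) (Icc 0 R) r :=
    fun c r hr => (hE r hr).mul (hexp c r).hasDerivWithinAt
  have hmono : MonotoneOn (fun x => E x * Real.exp (K * x)) (Icc 0 R) :=
    monotoneOn_of_hasDerivWithinAt_nonneg (convex_Icc 0 R)
      (fun r hr => (hd K r hr).continuousWithinAt)
      (fun r hr => (hd K r (interior_subset hr)).mono interior_subset) fun r hr => by
        have h := (abs_le.1 (hbound r (interior_subset hr))).1
        have : 0 ≤ (E' r + K * E r) * Real.exp (K * r) :=
          mul_nonneg (by linarith) (Real.exp_pos _).le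
        linarith
  have hanti : AntitoneOn (fun x => E x * Real.exp (-K * x)) (Icc 0 R) :=
    antitoneOn_of_hasDerivWithinAt_nonpos (convex_Icc 0 R)
      (fun r hr => (hd (-K) r hr).continuousWithinAt)
      (fun r hr => (hd (-K) r (interior_subset hr)).mono interior_subset) fun r hr => by
        have h := (abs_le.1 (hbound r (interior_subset hr))).2
        have : 0 ≤ (K * E r - E' r) * Real.exp (-K * r) :=
          mul_nonneg (by linarith) (Real.exp_pos _).le
        linarith
  intro r hr
  rcases le_total r₀ r with h | h
  · exact pos_of_mul_pos_left ((mul_pos hpos (Real.exp_pos _)).trans_le (hmono hr₀ hr h))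
      (Real.exp_pos _).le
  · exact pos_of_mul_pos_left ((mul_pos hpos (Real.exp_pos _)).trans_le (hanti hr hr₀ h))
      (Real.exp_pos _).le


/-- Zero counting for solutions of `f'' + Q f = 0` on `[0, R]`: if `∫₀^R |Q − 1| ≤ M`
then the number `N` of zeros of `f` is finite and satisfies `|N − R/π| ≤ M/π + 2`. -/
theorem zero_count_estimate
    (R M : ℝ) (hR : 0 < R) (hM : 0 ≤ M)
    (Q : ℝ → ℝ) (hQ : ContinuousOn Q (Set.Icc 0 R))
    (hQint : ∫ r in (0:ℝ)..R, |Q r - 1| ≤ M)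
    (f f' f'' : ℝ → ℝ)
    (hf : ∀ r ∈ Set.Icc (0:ℝ) R, HasDerivWithinAt f (f' r) (Set.Icc 0 R) r)
    (hf' : ∀ r ∈ Set.Icc (0:ℝ) R, HasDerivWithinAt f' (f'' r) (Set.Icc 0 R) r)
    (hf'' : ContinuousOn f'' (Set.Icc 0 R))
    (hode : ∀ r ∈ Set.Icc (0:ℝ) R, f'' r + Q r * f r = 0)
    (hne : ∃ r ∈ Set.Icc (0:ℝ) R, f r ≠ 0) :
    {r ∈ Set.Icc (0:ℝ) R | f r = 0}.Finite ∧
      |({r ∈ Set.Icc (0:ℝ) R | f r = 0}.ncard : ℝ) - R / Real.pi| ≤ M / Real.pi + 2 := by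
  have hπ := Real.pi_pos
  have hfc : ContinuousOn f (Icc 0 R) := fun r hr => (hf r hr).continuousWithinAt
  have hfc' : ContinuousOn f' (Icc 0 R) := fun r hr => (hf' r hr).continuousWithinAt
  set E : ℝ → ℝ := fun r => f r ^ 2 + f' r ^ 2 with hE
  have hEc : ContinuousOn E (Icc 0 R) := (hfc.pow 2).add (hfc'.pow 2)
  have hEd : ∀ r ∈ Icc (0:ℝ) R,
      HasDerivWithinAt E (2 * (1 - Q r) * (f r * f' r)) (Icc 0 R) r := fun r hr => by
    refine (((hf r hr).pow 2).add ((hf' r hr).pow 2)).congr_deriv ?_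
    rw [eq_neg_of_add_eq_zero_left (hode r hr)]
    push_cast
    ring
  obtain ⟨K, hK⟩ := isCompact_Icc.exists_bound_of_continuousOn
    ((continuousOn_const (c := (1:ℝ))).sub hQ)
  obtain ⟨r₀, hr₀, hfr₀⟩ := hne
  have hEpos : ∀ r ∈ Icc (0:ℝ) R, 0 < E r := by
    refine pos_of_abs_deriv_le (K := K) hEd (fun r hr => ?_) hr₀
      (add_pos_of_pos_of_nonneg (by positivity) (sq_nonneg _))
    have h1 : |1 - Q r| ≤ K := hK r hr
    have h2 : 2 * |f r * f' r| ≤ E r := by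
      rw [abs_mul]
      simpa [hE, mul_assoc] using two_mul_le_add_sq |f r| |f' r|
    calc |2 * (1 - Q r) * (f r * f' r)| = |1 - Q r| * (2 * |f r * f' r|) := by
          rw [abs_mul, abs_mul, abs_two]; ring
      _ ≤ K * E r := mul_le_mul h1 h2 (by positivity) ((abs_nonneg _).trans h1)
  set q : ℝ → ℝ := fun r => 1 + (Q r - 1) * f r ^ 2 / E r with hq
  have hqc : ContinuousOn q (Icc 0 R) :=
    continuousOn_const.add (((hQ.sub continuousOn_const).mul (hfc.pow 2)).div hEc
      fun r hr => (hEpos r hr).ne')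
  set p : ℝ → ℝ := IccExtend hR.le ((Icc 0 R).domRestrict q) with hp
  have hpc : Continuous p := hqc.domRestrict.Icc_extend'
  have hpq : ∀ r ∈ Icc (0:ℝ) R, p r = q r := fun r hr => IccExtend_of_mem hR.le _ hr
  set φ : ℝ → ℝ := fun r => Complex.arg ⟨f' 0, f 0⟩ + ∫ x in (0:ℝ)..r, p x with hφ
  have hφd : ∀ r, HasDerivAt φ (p r) r := fun r =>
    (hpc.integral_hasStrictDerivAt 0 r).hasDerivAt.const_add _
  set g : ℝ → ℝ := fun r => f r * Real.cos (φ r) - f' r * Real.sin (φ r) with hg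
  have hgd : ∀ r ∈ Icc (0:ℝ) R,
      HasDerivWithinAt (fun r => g r ^ 2 / E r) 0 (Icc 0 R) r := fun r hr => by
    have hφr := (hφd r).hasDerivWithinAt (s := Icc 0 R)
    have hgr : HasDerivWithinAt g _ (Icc 0 R) r :=
      ((hf r hr).mul hφr.cos).sub ((hf' r hr).mul hφr.sin)
    have hE0 := (hEpos r hr).ne'
    refine ((hgr.pow 2).div (hEd r hr) hE0).congr_deriv ?_
    have hEq : E r * p r = f' r ^ 2 + Q r * f r ^ 2 := by
      rw [hpq r hr, hq]
      field_simp
      simp only [hE]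
      ring
    rw [eq_neg_of_add_eq_zero_left (hode r hr), div_eq_zero_iff]
    left
    simp only [hg, Pi.pow_apply]
    push_cast
    have hEr : E r = f r ^ 2 + f' r ^ 2 := rfl
    generalize Real.cos (φ r) = c at *
    generalize Real.sin (φ r) = s at *
    linear_combination (2 * (f r * c - f' r * s) * (-f r * s - f' r * c)) * hEq +
      (2 * (f r * c - f' r * s) * (f' r * c + Q r * f r * s)) * hEr
  have hφ0 : φ 0 = Complex.arg ⟨f' 0, f 0⟩ := by simp [hφ]
  have hg0 : g 0 = 0 := by
    have h0 : (⟨f' 0, f 0⟩ : ℂ) ≠ 0 := fun h => by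
      have h1 := congrArg Complex.re h
      have h2 := congrArg Complex.im h
      have := hEpos 0 (left_mem_Icc.2 hR.le)
      simp_all
    simp only [hg]
    rw [hφ0, Complex.cos_arg h0, Complex.sin_arg]
    ring
  have hgz : ∀ r ∈ Icc (0:ℝ) R, g r = 0 := fun r hr => by
    have h := constant_of_derivWithin_zero (fun x hx => (hgd x hx).differentiableWithinAt)
      (fun x hx => (hgd x (Ico_subset_Icc_self hx)).derivWithin
        (uniqueDiffOn_Icc hR x (Ico_subset_Icc_self hx))) r hr
    simpa [hg0, (hEpos r hr).ne'] using h
  have hiff : ∀ r ∈ Icc (0:ℝ) R, f r = 0 ↔ Real.sin (φ r) = 0 := fun r hr => by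
    have h := hgz r hr
    have hE0 := hEpos r hr
    simp only [hg] at h
    constructor
    · intro h0
      have : f' r ≠ 0 := fun h1 => by simp [hE, h0, h1] at hE0
      simpa [h0, this] using h
    · intro h0
      have : Real.cos (φ r) ≠ 0 := fun h1 => by
        simpa [h0, h1] using Real.sin_sq_add_cos_sq (φ r)
      simpa [h0, this] using h
  have hset : {r ∈ Icc (0:ℝ) R | f r = 0} = {r ∈ Icc (0:ℝ) R | Real.sin (φ r) = 0} := by
    ext r
    exact and_congr_right (hiff r)
  obtain ⟨hfin, hcount⟩ := finite_and_ncard_sin_eq_zero hφd hR fun r hr h => by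
    simp [hpq r hr, hq, (hiff r hr).2 h]
  rw [hset]
  refine ⟨hfin, ?_⟩
  have hint : φ R - φ 0 - R = ∫ r in (0:ℝ)..R, (p r - 1) := by
    rw [intervalIntegral.integral_sub (hpc.intervalIntegrable _ _) (by simp), hφ0]
    simp [hφ]
  have hle : |φ R - φ 0 - R| ≤ M := by
    rw [hint]
    refine (intervalIntegral.abs_integral_le_integral_abs hR.le).trans (le_trans ?_ hQint)
    refine intervalIntegral.integral_mono_on hR.le
      ((hpc.sub continuous_const).abs.intervalIntegrable _ _)
      (((hQ.sub continuousOn_const).abs).intervalIntegrable_of_Icc hR.le) fun r hr => ?_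
    have hE0 := hEpos r hr
    rw [hpq r hr, hq, add_sub_cancel_left, mul_div_assoc, abs_mul]
    refine mul_le_of_le_one_right (abs_nonneg _) ?_
    rw [abs_of_nonneg (by positivity), div_le_one hE0]
    exact le_add_of_nonneg_right (sq_nonneg _)
  have hle' : |(φ R - φ 0) / Real.pi - R / Real.pi| ≤ M / Real.pi := by
    rw [← sub_div, abs_div, abs_of_pos hπ]
    exact div_le_div_of_nonneg_right hle hπ.le
  refine (abs_sub_le _ ((φ R - φ 0) / Real.pi) _).trans ?_
  linarith
end

section
/- Let d ∈ ℝ, let λ > 0, let m : [1, ∞) → ℝ satisfy m(r) ≤ 0 for all r ≥ 1, and let X : [1, ∞) → ℝ be twice differentiable satisfying r² X''(r) + (d − 1) r X'(r) + (m(r) − λ r²) X(r) = 0 for all r ≥ 1 and X(r) → 0 as r → ∞. Then X(1) X'(1) ≤ 0; moreover, if X(1) X'(1) = 0 then X(1) = 0 and X'(1) = 0. -/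
/-- A function which is differentiable on `[1, ∞)` with nonnegative derivative is monotone there. -/
theorem monotoneOn_Ici_one_of_hasDerivWithinAt_nonneg {f f' : ℝ → ℝ}
    (hf : ∀ r ∈ Set.Ici (1:ℝ), HasDerivWithinAt f (f' r) (Set.Ici 1) r)
    (hf' : ∀ r ∈ Set.Ici (1:ℝ), 0 ≤ f' r) : MonotoneOn f (Set.Ici 1) :=
  monotoneOn_of_hasDerivWithinAt_nonneg (convex_Ici 1)
    (fun r hr => (hf r hr).continuousWithinAt)
    (fun r hr => (hf r (interior_subset hr)).mono interior_subset)
    (fun r hr => hf' r (interior_subset hr))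

/-- Along a solution of the radial equation, the flux `r ^ (d - 1) X X'` is monotone. -/
theorem monotoneOn_radial_flux
    (d lam : ℝ) (hlam : 0 < lam)
    (m : ℝ → ℝ) (hm : ∀ r ∈ Set.Ici (1:ℝ), m r ≤ 0)
    (X X' X'' : ℝ → ℝ)
    (hX : ∀ r ∈ Set.Ici (1:ℝ), HasDerivWithinAt X (X' r) (Set.Ici 1) r)
    (hX' : ∀ r ∈ Set.Ici (1:ℝ), HasDerivWithinAt X' (X'' r) (Set.Ici 1) r)
    (hode : ∀ r ∈ Set.Ici (1:ℝ),
      r ^ 2 * X'' r + (d - 1) * r * X' r + (m r - lam * r ^ 2) * X r = 0) :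
    MonotoneOn (fun r => r ^ (d - 1) * (X r * X' r)) (Set.Ici 1) := by
  refine monotoneOn_Ici_one_of_hasDerivWithinAt_nonneg
    (f' := fun r => r ^ (d - 1) * (X' r ^ 2 + (lam - m r / r ^ 2) * X r ^ 2)) ?_ ?_
  · intro r hr
    have hr0 : 0 < r := zero_lt_one.trans_le hr
    have hpow : HasDerivWithinAt (fun s : ℝ => s ^ (d - 1)) ((d - 1) * r ^ (d - 1 - 1))
        (Set.Ici 1) r := (Real.hasDerivAt_rpow_const (Or.inl hr0.ne')).hasDerivWithinAt
    refine (hpow.mul ((hX r hr).mul (hX' r hr))).congr_deriv ?_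
    rw [Real.rpow_sub_one hr0.ne' (d - 1)]
    simp only [Pi.mul_apply]
    field_simp
    linear_combination X r * hode r hr
  · intro r hr
    have hr0 : 0 < r := zero_lt_one.trans_le hr
    have hq : m r / r ^ 2 ≤ 0 := div_nonpos_of_nonpos_of_nonneg (hm r hr) (sq_nonneg r)
    have hc : 0 ≤ lam - m r / r ^ 2 := by linarith
    positivity

/-- A decaying solution of the radial equation with `X(1) X'(1) ≥ 0` vanishes on `[1, ∞)`. -/
theorem eq_zero_of_radial_ode_of_nonneg
    (d lam : ℝ) (hlam : 0 < lam)
    (m : ℝ → ℝ) (hm : ∀ r ∈ Set.Ici (1:ℝ), m r ≤ 0)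
    (X X' X'' : ℝ → ℝ)
    (hX : ∀ r ∈ Set.Ici (1:ℝ), HasDerivWithinAt X (X' r) (Set.Ici 1) r)
    (hX' : ∀ r ∈ Set.Ici (1:ℝ), HasDerivWithinAt X' (X'' r) (Set.Ici 1) r)
    (hode : ∀ r ∈ Set.Ici (1:ℝ),
      r ^ 2 * X'' r + (d - 1) * r * X' r + (m r - lam * r ^ 2) * X r = 0)
    (hdecay : Filter.Tendsto X Filter.atTop (nhds 0))
    (h0 : 0 ≤ X 1 * X' 1) : ∀ r ∈ Set.Ici (1:ℝ), X r = 0 := by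
  have hflux := monotoneOn_radial_flux d lam hlam m hm X X' X'' hX hX' hode
  have hsq : MonotoneOn (fun r => X r ^ 2) (Set.Ici 1) := by
    refine monotoneOn_Ici_one_of_hasDerivWithinAt_nonneg
      (f' := fun r => 2 * (X r * X' r)) (fun r hr => ?_) (fun r hr => ?_)
    · exact ((hX r hr).pow 2).congr_deriv (by simp; ring)
    · have hle := hflux Set.self_mem_Ici hr hr
      simp only [Real.one_rpow, one_mul] at hle
      have hr0 : 0 < r := zero_lt_one.trans_le hr
      have := nonneg_of_mul_nonneg_right (h0.trans hle) (Real.rpow_pos_of_pos hr0 (d - 1))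
      positivity
  intro r hr
  have hlim : Filter.Tendsto (fun s => X s ^ 2) Filter.atTop (nhds 0) := by
    simpa using hdecay.pow 2
  have hle : X r ^ 2 ≤ 0 := by
    refine ge_of_tendsto hlim ?_
    filter_upwards [Filter.eventually_ge_atTop r] with s hs
    exact hsq hr (le_trans hr hs) hs
  exact pow_eq_zero_iff two_ne_zero |>.1 (le_antisymm hle (sq_nonneg _))


/-- For a decaying solution of `r² X'' + (d−1) r X' + (m(r) − λ r²) X = 0` on `[1, ∞)`
with `m ≤ 0` and `λ > 0`, one has `X(1) X'(1) ≤ 0`, with equality only if both vanish. -/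
theorem outer_radial_sign_condition
    (d lam : ℝ) (hlam : 0 < lam)
    (m : ℝ → ℝ) (hm : ∀ r ∈ Set.Ici (1:ℝ), m r ≤ 0)
    (X X' X'' : ℝ → ℝ)
    (hX : ∀ r ∈ Set.Ici (1:ℝ), HasDerivWithinAt X (X' r) (Set.Ici 1) r)
    (hX' : ∀ r ∈ Set.Ici (1:ℝ), HasDerivWithinAt X' (X'' r) (Set.Ici 1) r)
    (hode : ∀ r ∈ Set.Ici (1:ℝ),
      r ^ 2 * X'' r + (d - 1) * r * X' r + (m r - lam * r ^ 2) * X r = 0)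
    (hdecay : Filter.Tendsto X Filter.atTop (nhds 0)) :
    X 1 * X' 1 ≤ 0 ∧ (X 1 * X' 1 = 0 → X 1 = 0 ∧ X' 1 = 0) := by
  have key : 0 ≤ X 1 * X' 1 → X 1 = 0 ∧ X' 1 = 0 := by
    intro h0
    have hvanish := eq_zero_of_radial_ode_of_nonneg d lam hlam m hm X X' X'' hX hX' hode hdecay h0
    have h1 : (1:ℝ) ∈ Set.Ici (1:ℝ) := Set.self_mem_Ici
    refine ⟨hvanish 1 h1, ?_⟩
    have hzero : HasDerivWithinAt X 0 (Set.Ici 1) 1 :=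
      (hasDerivWithinAt_const (1:ℝ) (Set.Ici 1) (0:ℝ)).congr hvanish (hvanish 1 h1)
    exact (uniqueDiffOn_Ici (1:ℝ) 1 h1).eq_deriv _ (hX 1 h1) hzero
  refine ⟨?_, fun h => key h.ge⟩
  by_contra! hpos
  simp [(key hpos.le).1] at hpos
end

section
/- Let d ∈ ℝ, ν > 0 and λ > 0, and let Y : [0, 1] → ℝ be continuous with Y(0) = 0 and twice differentiable on (0, 1], satisfying r² Y''(r) + (d − 1) r Y'(r) − (ν + λ r²) Y(r) = 0 for all r ∈ (0, 1]. Then Y(1) Y'(1) ≥ 0; moreover, if Y(1) Y'(1) = 0 then Y(1) = 0 and Y'(1) = 0. -/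
/-- For a solution of `r² Y'' + (d−1) r Y' − (ν + λ r²) Y = 0` on `(0, 1]` with `Y(0)=0`,
`ν > 0`, `λ > 0`, one has `Y(1) Y'(1) ≥ 0`, with equality only if both vanish. -/
theorem inner_radial_sign_condition
    (d ν lam : ℝ) (hν : 0 < ν) (hlam : 0 < lam)
    (Y Y' Y'' : ℝ → ℝ)
    (hYcont : ContinuousOn Y (Set.Icc 0 1))
    (hY0 : Y 0 = 0)
    (hY : ∀ r ∈ Set.Ioc (0:ℝ) 1, HasDerivWithinAt Y (Y' r) (Set.Ioc 0 1) r)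
    (hY' : ∀ r ∈ Set.Ioc (0:ℝ) 1, HasDerivWithinAt Y' (Y'' r) (Set.Ioc 0 1) r)
    (hode : ∀ r ∈ Set.Ioc (0:ℝ) 1,
      r ^ 2 * Y'' r + (d - 1) * r * Y' r - (ν + lam * r ^ 2) * Y r = 0) :
    0 ≤ Y 1 * Y' 1 ∧ (Y 1 * Y' 1 = 0 → Y 1 = 0 ∧ Y' 1 = 0) := by
  have key : Y 1 * Y' 1 ≤ 0 → Y 1 = 0 ∧ Y' 1 = 0 := by
    intro h
    have hderiv : ∀ r ∈ Set.Ioc (0:ℝ) 1,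
        HasDerivWithinAt (fun r ↦ r ^ (d - 1) * (Y r * Y' r))
          (r ^ (d - 1) * (Y' r ^ 2 + (ν / r ^ 2 + lam) * Y r ^ 2)) (Set.Ioc 0 1) r := by
      intro r hr
      have hr0 : r ≠ 0 := hr.1.ne'
      have h1 := (Real.hasDerivAt_rpow_const (p := d - 1) (Or.inl hr0)).hasDerivWithinAt
        (s := Set.Ioc (0:ℝ) 1)
      refine (h1.mul ((hY r hr).mul (hY' r hr))).congr_deriv ?_
      have hY'' : Y'' r = (ν / r ^ 2 + lam) * Y r - (d - 1) / r * Y' r := by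
        field_simp
        linarith [hode r hr]
      simp only [Pi.mul_apply]
      rw [hY'', Real.rpow_sub_one hr0 (d - 1)]
      field_simp
      ring
    have hmono : MonotoneOn (fun r ↦ r ^ (d - 1) * (Y r * Y' r)) (Set.Ioc 0 1) := by
      refine monotoneOn_of_hasDerivWithinAt_nonneg (convex_Ioc 0 1)
        (fun r hr ↦ (hderiv r hr).continuousWithinAt)
        (fun r hr ↦ (hderiv r (interior_subset hr)).mono interior_subset) fun r hr ↦ ?_
      have := (interior_subset hr : r ∈ Set.Ioc (0:ℝ) 1).1
      positivity
    have hone : (1:ℝ) ∈ Set.Ioc (0:ℝ) 1 := by simp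
    have hnonpos : ∀ r ∈ Set.Ioc (0:ℝ) 1, Y r * Y' r ≤ 0 := by
      intro r hr
      have hle := hmono hr hone hr.2
      simp only [Real.one_rpow, one_mul] at hle
      exact nonpos_of_mul_nonpos_right (hle.trans h) (Real.rpow_pos_of_pos hr.1 _)
    have hsub : interior (Set.Icc (0:ℝ) 1) ⊆ Set.Ioc 0 1 := by
      rw [interior_Icc]
      exact Set.Ioo_subset_Ioc_self
    have hanti : AntitoneOn (fun r ↦ Y r ^ 2) (Set.Icc 0 1) := by
      refine antitoneOn_of_hasDerivWithinAt_nonpos (convex_Icc 0 1) (hYcont.pow 2)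
        (fun r hr ↦ ((hY r (hsub hr)).mono hsub).pow 2) fun r hr ↦ ?_
      have := hnonpos r (hsub hr)
      norm_num
      linarith
    have hzero : ∀ r ∈ Set.Ioc (0:ℝ) 1, Y r = 0 := by
      intro r hr
      have hle := hanti (Set.left_mem_Icc.2 zero_le_one) (Set.Ioc_subset_Icc_self hr) hr.1.le
      simp only [hY0] at hle
      nlinarith
    refine ⟨hzero 1 hone, ?_⟩
    exact (uniqueDiffOn_Ioc 0 1 1 hone).eq_deriv _ (hY 1 hone)
      ((hasDerivWithinAt_const 1 (Set.Ioc 0 1) (0:ℝ)).congr hzero (hzero 1 hone))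
  refine ⟨?_, fun h ↦ key h.le⟩
  by_contra! h
  obtain ⟨h1, -⟩ := key h.le
  simp [h1] at h
end

section
/- Let α < −1/2 be a real number and set μ = −α(α + 1). Define X : (0, ∞) → ℝ by X(r) = r^α ∫_{−∞}^{∞} (p² + 1)^α cos(p r) dp (the integral converges absolutely since α < −1/2). Then X is twice differentiable on (0, ∞) and satisfies r² X''(r) + 2 r X'(r) + (μ − r²) X(r) = 0 for all r > 0. -/
open MeasureTheory

open Real Set Filter Topology

/-- The integrand of the heat-kernel representation of the MacDonald function. -/
noncomputable def macdonaldKernel (ν b t : ℝ) : ℝ := t ^ ν * exp (-t - b / t)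

theorem macdonaldKernel_nonneg (ν b : ℝ) {t : ℝ} (ht : 0 < t) : 0 ≤ macdonaldKernel ν b t := by
  unfold macdonaldKernel; positivity

theorem measurable_macdonaldKernel (ν b : ℝ) : Measurable (macdonaldKernel ν b) := by
  unfold macdonaldKernel; fun_prop

theorem macdonaldKernel_anti (ν : ℝ) {b b' t : ℝ} (ht : 0 < t) (h : b ≤ b') :
    macdonaldKernel ν b' t ≤ macdonaldKernel ν b t := by
  unfold macdonaldKernel; gcongr

theorem macdonaldKernel_sub_one (ν b : ℝ) {t : ℝ} (ht : 0 < t) :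
    macdonaldKernel (ν - 1) b t = macdonaldKernel ν b t / t := by
  unfold macdonaldKernel; rw [rpow_sub_one ht.ne']; ring

theorem macdonaldKernel_le (ν : ℝ) {b t : ℝ} (hb : 0 < b) (ht : 0 < t) (n : ℕ) :
    macdonaldKernel ν b t ≤ n.factorial / b ^ n * (exp (-t) * t ^ (ν + n)) := by
  have h := pow_div_factorial_le_exp (b / t) (div_nonneg hb.le ht.le) n
  have h2 : exp (-(b / t)) ≤ n.factorial / b ^ n * t ^ n := by
    rw [exp_neg]
    have : (n.factorial / b ^ n * t ^ n : ℝ) = ((b / t) ^ n / n.factorial)⁻¹ := by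
      rw [div_pow]
      field_simp
    rw [this]
    exact inv_anti₀ (by positivity) h
  unfold macdonaldKernel
  rw [sub_eq_add_neg, exp_add, rpow_add ht, rpow_natCast]
  calc t ^ ν * (exp (-t) * exp (-(b / t)))
      ≤ t ^ ν * (exp (-t) * (n.factorial / b ^ n * t ^ n)) := by gcongr
    _ = _ := by ring

theorem integrableOn_macdonaldKernel (ν : ℝ) {b : ℝ} (hb : 0 < b) :
    IntegrableOn (macdonaldKernel ν b) (Ioi 0) := by
  obtain ⟨n, hn⟩ := exists_nat_gt (-ν)
  have h := (GammaIntegral_convergent (s := ν + n + 1) (by linarith)).const_mul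
    (n.factorial / b ^ n : ℝ)
  refine Integrable.mono' h (measurable_macdonaldKernel ν b).aestronglyMeasurable ?_
  filter_upwards [self_mem_ae_restrict measurableSet_Ioi] with t ht
  rw [norm_of_nonneg (macdonaldKernel_nonneg ν b ht), add_sub_cancel_right]
  exact macdonaldKernel_le ν hb ht n

theorem tendsto_macdonaldKernel_nhdsGT_zero (ν : ℝ) {b : ℝ} (hb : 0 < b) :
    Tendsto (macdonaldKernel ν b) (𝓝[>] 0) (𝓝 0) := by
  obtain ⟨n, hn⟩ := exists_nat_gt (-ν)
  have hc : Tendsto (fun t : ℝ => n.factorial / b ^ n * (exp (-t) * t ^ (ν + n))) (𝓝[>] 0)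
      (𝓝 0) := by
    have : ContinuousAt (fun t : ℝ => n.factorial / b ^ n * (exp (-t) * t ^ (ν + n))) 0 := by
      have := continuousAt_rpow_const 0 (ν + n) (Or.inr (by linarith))
      fun_prop
    have h := this.tendsto
    simp only [zero_rpow (show ν + n ≠ 0 by linarith), mul_zero] at h
    exact h.mono_left nhdsWithin_le_nhds
  refine squeeze_zero' ?_ ?_ hc <;> filter_upwards [self_mem_nhdsWithin] with t ht
  · exact macdonaldKernel_nonneg ν b ht
  · exact macdonaldKernel_le ν hb ht n

theorem tendsto_macdonaldKernel_atTop (ν : ℝ) {b : ℝ} (hb : 0 < b) :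
    Tendsto (macdonaldKernel ν b) atTop (𝓝 0) := by
  refine squeeze_zero' ?_ ?_ (tendsto_rpow_mul_exp_neg_mul_atTop_nhds_zero ν 1 one_pos) <;>
    filter_upwards [eventually_gt_atTop 0] with t ht
  · exact macdonaldKernel_nonneg ν b ht
  · unfold macdonaldKernel
    gcongr
    have : 0 ≤ b / t := by positivity
    linarith

theorem hasDerivAt_integral_macdonaldKernel (ν : ℝ) {b : ℝ} (hb : 0 < b) :
    HasDerivAt (fun b => ∫ t in Ioi 0, macdonaldKernel ν b t)
      (-∫ t in Ioi 0, macdonaldKernel (ν - 1) b t) b := by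
  rw [← integral_neg]
  refine (hasDerivAt_integral_of_dominated_loc_of_deriv_le (s := Ioi (b / 2))
    (F := fun b t => macdonaldKernel ν b t) (F' := fun b t => -macdonaldKernel (ν - 1) b t)
    (bound := macdonaldKernel (ν - 1) (b / 2))
    (Ioi_mem_nhds (by linarith)) ?_ (integrableOn_macdonaldKernel ν hb) ?_ ?_
    (integrableOn_macdonaldKernel _ (by linarith)) ?_).2
  · exact Eventually.of_forall fun c => (measurable_macdonaldKernel ν c).aestronglyMeasurable
  · exact (measurable_macdonaldKernel _ b).neg.aestronglyMeasurable
  · filter_upwards [self_mem_ae_restrict measurableSet_Ioi] with t ht c hc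
    rw [norm_neg, norm_of_nonneg (macdonaldKernel_nonneg _ c ht)]
    exact macdonaldKernel_anti _ ht (le_of_lt hc)
  · filter_upwards [self_mem_ae_restrict measurableSet_Ioi] with t ht c hc
    have h := ((((hasDerivAt_id c).div_const t).const_sub (-t)).exp).const_mul (t ^ ν)
    convert! h using 1
    rw [macdonaldKernel_sub_one ν c ht]
    simp only [macdonaldKernel, id]
    ring

theorem integral_macdonaldKernel_recurrence (ν : ℝ) {b : ℝ} (hb : 0 < b) :
    ν * (∫ t in Ioi 0, macdonaldKernel (ν - 1) b t) - (∫ t in Ioi 0, macdonaldKernel ν b t) +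
      b * (∫ t in Ioi 0, macdonaldKernel (ν - 2) b t) = 0 := by
  have e : ∀ t ∈ Ioi (0 : ℝ), (ν * t ^ (ν - 1)) * exp (-t - b / t) +
      t ^ ν * (exp (-t - b / t) * (-1 + b / t ^ 2)) =
      ν * macdonaldKernel (ν - 1) b t - macdonaldKernel ν b t +
        b * macdonaldKernel (ν - 2) b t := by
    intro t (ht : 0 < t)
    rw [show ν - 2 = ν - 1 - 1 by ring, macdonaldKernel_sub_one (ν - 1) b ht,
      macdonaldKernel_sub_one ν b ht]
    unfold macdonaldKernel
    rw [rpow_sub_one ht.ne']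
    field_simp
    ring
  have i0 := integrableOn_macdonaldKernel ν hb
  have i1 := (integrableOn_macdonaldKernel (ν - 1) hb).const_mul ν
  have i2 := (integrableOn_macdonaldKernel (ν - 2) hb).const_mul b
  have h := integral_Ioi_deriv_mul_eq_sub (a := 0) (a' := 0) (b' := 0)
    (u := fun t : ℝ => t ^ ν) (v := fun t => exp (-t - b / t))
    (u' := fun t => ν * t ^ (ν - 1)) (v' := fun t => exp (-t - b / t) * (-1 + b / t ^ 2))
    (fun t ht => hasDerivAt_rpow_const (Or.inl (ne_of_gt ht)))
    (fun t (ht : 0 < t) => by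
      have := ((hasDerivAt_id t).neg.sub
        ((hasDerivAt_inv ht.ne').const_mul b)).exp
      convert! this using 1
      simp only [Pi.sub_apply, Pi.neg_apply, id, ← div_eq_mul_inv]
      ring)
    (IntegrableOn.congr_fun ((i1.sub i0).add i2) (fun t ht => (e t ht).symm) measurableSet_Ioi)
    (tendsto_macdonaldKernel_nhdsGT_zero ν hb) (tendsto_macdonaldKernel_atTop ν hb)
  rw [setIntegral_congr_fun measurableSet_Ioi e, integral_add
    (f := fun t => ν * macdonaldKernel (ν - 1) b t - macdonaldKernel ν b t) (i1.sub i0) i2,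
    integral_sub i1 i0, integral_const_mul, integral_const_mul] at h
  simpa using h

theorem integral_exp_neg_mul_sq_mul_cos {t : ℝ} (ht : 0 < t) (r : ℝ) :
    ∫ p : ℝ, exp (-t * p ^ 2) * cos (p * r) = sqrt (π / t) * exp (-r ^ 2 / (4 * t)) := by
  have h := fourierIntegral_gaussian (b := (t : ℂ)) (by simpa using ht) (r : ℂ)
  have hint : Integrable fun p : ℝ =>
      Complex.exp (Complex.I * r * p) * Complex.exp (-(t : ℂ) * (p : ℂ) ^ 2) := by
    refine (integrable_exp_neg_mul_sq ht).mono' (by fun_prop) (Eventually.of_forall fun p => ?_)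
    rw [norm_mul, Complex.norm_exp, Complex.norm_exp]
    simp [← Complex.ofReal_pow]
  have h2 := congrArg Complex.re h
  have h3 := integral_re hint
  simp only [RCLike.re_eq_complex_re] at h3
  rw [← h3] at h2
  convert h2 using 1
  · refine integral_congr_ae (Eventually.of_forall fun p => ?_)
    simp only
    rw [show (-(t : ℂ) * (p : ℂ) ^ 2) = ((-t * p ^ 2 : ℝ) : ℂ) by push_cast; ring,
      ← Complex.ofReal_exp, Complex.re_mul_ofReal, Complex.exp_re]
    simp [mul_comm]
  · rw [show (π / t : ℂ) = ((π / t : ℝ) : ℂ) by push_cast; ring,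
      show (-(r : ℂ) ^ 2 / (4 * t)) = ((-r ^ 2 / (4 * t) : ℝ) : ℂ) by push_cast; ring,
      show (1 / 2 : ℂ) = ((1 / 2 : ℝ) : ℂ) by push_cast; ring,
      ← Complex.ofReal_cpow (by positivity), ← Complex.ofReal_exp, ← Complex.ofReal_mul,
      Complex.ofReal_re, sqrt_eq_rpow]

theorem integrable_gamma_subordination {s : ℝ} (hs : 1 / 2 < s) :
    Integrable (fun z : ℝ × ℝ => z.2 ^ (s - 1) * exp (-((z.1 ^ 2 + 1) * z.2)))
      (volume.prod (volume.restrict (Ioi 0))) := by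
  rw [integrable_prod_iff (Measurable.aestronglyMeasurable (by fun_prop))]
  have hG (p : ℝ) := integral_rpow_mul_exp_neg_mul_Ioi (a := s) (r := p ^ 2 + 1)
    (by linarith) (by positivity)
  have hpos : 0 < Gamma s := Gamma_pos_of_pos (by linarith)
  refine ⟨Eventually.of_forall fun p => .of_integral_ne_zero ?_, ?_⟩
  · rw [hG]; positivity
  · have h := (integrable_rpow_neg_one_add_norm_sq (E := ℝ) (μ := volume) (r := 2 * s)
      (by simp; linarith)).mul_const (Gamma s)
    refine h.congr (Eventually.of_forall fun p => ?_)
    simp only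
    rw [setIntegral_congr_fun (g := fun t => t ^ (s - 1) * exp (-((p ^ 2 + 1) * t)))
      measurableSet_Ioi fun t (ht : 0 < t) => norm_of_nonneg (by positivity), hG, norm_eq_abs,
      sq_abs, one_div, inv_rpow (by positivity), ← rpow_neg (by positivity), add_comm]
    congr 2
    ring

theorem integral_rpow_mul_cos_eq {s : ℝ} (hs : 1 / 2 < s) (r : ℝ) :
    ∫ p : ℝ, (p ^ 2 + 1) ^ (-s) * cos (p * r) =
      sqrt π / Gamma s * ∫ t in Ioi 0, macdonaldKernel (s - 3 / 2) (r ^ 2 / 4) t := by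
  have hpos : 0 < Gamma s := Gamma_pos_of_pos (by linarith)
  have hint : Integrable (Function.uncurry fun p t : ℝ =>
      t ^ (s - 1) * exp (-((p ^ 2 + 1) * t)) * cos (p * r))
      (volume.prod (volume.restrict (Ioi 0))) := by
    refine (integrable_gamma_subordination hs).norm.mono'
      (Measurable.aestronglyMeasurable (by fun_prop)) (Eventually.of_forall fun z => ?_)
    rw [Function.uncurry_def, norm_mul]
    exact mul_le_of_le_one_right (norm_nonneg _) (abs_cos_le_one _)
  have h := integral_integral_swap hint
  have e1 : ∀ p : ℝ, ∫ t in Ioi 0, t ^ (s - 1) * exp (-((p ^ 2 + 1) * t)) * cos (p * r) =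
      Gamma s * ((p ^ 2 + 1) ^ (-s) * cos (p * r)) := fun p => by
    rw [integral_mul_const, integral_rpow_mul_exp_neg_mul_Ioi (by linarith) (by positivity),
      one_div, inv_rpow (by positivity), ← rpow_neg (by positivity)]
    ring
  have e2 : ∀ t ∈ Ioi (0 : ℝ),
      ∫ p : ℝ, t ^ (s - 1) * exp (-((p ^ 2 + 1) * t)) * cos (p * r) =
        sqrt π * macdonaldKernel (s - 3 / 2) (r ^ 2 / 4) t := fun t (ht : 0 < t) => by
    have : ∀ p : ℝ, t ^ (s - 1) * exp (-((p ^ 2 + 1) * t)) * cos (p * r) =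
        t ^ (s - 1) * exp (-t) * (exp (-t * p ^ 2) * cos (p * r)) := fun p => by
      rw [show -((p ^ 2 + 1) * t) = -t + -t * p ^ 2 by ring, exp_add]
      ring
    simp only [this]
    rw [integral_const_mul, integral_exp_neg_mul_sq_mul_cos ht, sqrt_div pi_pos.le,
      macdonaldKernel, show -t - r ^ 2 / 4 / t = -t + -r ^ 2 / (4 * t) by field_simp; ring,
      exp_add, show s - 3 / 2 = s - 1 - 1 / 2 by ring, rpow_sub ht (s - 1), ← sqrt_eq_rpow]
    ring
  simp only [e1] at h
  rw [integral_const_mul, setIntegral_congr_fun measurableSet_Ioi e2, integral_const_mul] at h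
  rw [div_mul_eq_mul_div, eq_div_iff hpos.ne', mul_comm, h]

theorem hasDerivAt_integral_macdonaldKernel_sq (ν : ℝ) {r : ℝ} (hr : 0 < r) :
    HasDerivAt (fun r : ℝ => ∫ t in Ioi 0, macdonaldKernel ν (r ^ 2 / 4) t)
      (-(r / 2) * ∫ t in Ioi 0, macdonaldKernel (ν - 1) (r ^ 2 / 4) t) r := by
  have h := (hasDerivAt_integral_macdonaldKernel ν (b := r ^ 2 / 4) (by positivity)).comp r
    ((hasDerivAt_pow 2 r).div_const 4)
  convert! h using 1
  norm_num
  ring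

/-- For `α < −1/2` and `μ = −α(α+1)`, the function
`X(r) = r^α ∫ (p²+1)^α cos(pr) dp` solves `r² X'' + 2 r X' + (μ − r²) X = 0` on `(0, ∞)`. -/
theorem macdonald_solution
    (α : ℝ) (hα : α < -(1/2)) :
    ∃ X' X'' : ℝ → ℝ,
      (∀ r ∈ Set.Ioi (0:ℝ),
        HasDerivAt (fun r : ℝ => r ^ α * ∫ p : ℝ, (p ^ 2 + 1) ^ α * Real.cos (p * r))
          (X' r) r ∧
        HasDerivAt X' (X'' r) r) ∧
      ∀ r ∈ Set.Ioi (0:ℝ),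
        r ^ 2 * X'' r + 2 * r * X' r +
          (-α * (α + 1) - r ^ 2) *
            (r ^ α * ∫ p : ℝ, (p ^ 2 + 1) ^ α * Real.cos (p * r)) = 0 := by
  have hI (r : ℝ) := integral_rpow_mul_cos_eq (s := -α) (by linarith) r
  simp only [neg_neg] at hI
  simp only [hI]
  set c := sqrt π / Gamma (-α)
  set ν := -α - 3 / 2 with hν
  let G (k r : ℝ) : ℝ := ∫ t in Ioi 0, macdonaldKernel (ν - k) (r ^ 2 / 4) t
  have hG (k : ℝ) {r : ℝ} (hr : 0 < r) : HasDerivAt (G k) (-(r / 2) * G (k + 1) r) r := by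
    have := hasDerivAt_integral_macdonaldKernel_sq (ν - k) hr
    rwa [sub_sub ν k 1] at this
  have hG0 : ∀ r, ∫ t in Ioi 0, macdonaldKernel ν (r ^ 2 / 4) t = G 0 r := by simp [G]
  simp only [hG0]
  refine ⟨fun r => α * r ^ (α - 1) * (c * G 0 r) + r ^ α * (c * (-(r / 2) * G 1 r)),
    fun r => (α * ((α - 1) * r ^ (α - 1 - 1)) * (c * G 0 r) +
      α * r ^ (α - 1) * (c * (-(r / 2) * G 1 r))) +
      (α * r ^ (α - 1) * (c * (-(r / 2) * G 1 r)) +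
        r ^ α * (c * (-(1 / 2) * G 1 r + -(r / 2) * (-(r / 2) * G 2 r)))),
    fun r (hr : 0 < r) => ?_, fun r (hr : 0 < r) => ?_⟩
  · have h0 := hG 0 hr
    have h1 := hG 1 hr
    rw [zero_add] at h0
    rw [one_add_one_eq_two] at h1
    have hp (β : ℝ) : HasDerivAt (fun r : ℝ => r ^ β) (β * r ^ (β - 1)) r :=
      hasDerivAt_rpow_const (Or.inl hr.ne')
    exact ⟨(hp α).mul (h0.const_mul c),
      (((hp (α - 1)).const_mul α).mul (h0.const_mul c)).add
        ((hp α).mul ((((hasDerivAt_id r).div_const 2).neg.mul h1).const_mul c))⟩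
  · have hrec := integral_macdonaldKernel_recurrence ν (b := r ^ 2 / 4) (by positivity)
    change ν * G 1 r - (∫ t in Ioi 0, macdonaldKernel ν (r ^ 2 / 4) t) + r ^ 2 / 4 * G 2 r = 0
      at hrec
    rw [hG0, hν] at hrec
    beta_reduce
    rw [rpow_sub_one hr.ne' (α - 1), rpow_sub_one hr.ne' α]
    field_simp
    linear_combination (4 * r ^ 2 * r ^ α * c) * hrec
end

section
/- Let α ≤ −1 be a real number, define F : ℝ → ℝ by F(u) = ∫_{−∞}^{∞} (p² + 1)^α cos(p u) dp and X : (0, ∞) → ℝ by X(r) = r^α F(r). Then c := ∫_{−∞}^{∞} F(u)² du is finite, and for all λ > 0 and ρ > 0, ∫_ρ^∞ X(r √λ)² r² dr ≤ c · ρ^{2α+2} λ^{α − 1/2}. -/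
open MeasureTheory

/-- The weight `(p² + 1) ^ α` is integrable for `α ≤ -1`. -/
lemma integrable_sq_add_one_rpow {α : ℝ} (hα : α ≤ -1) :
    Integrable (fun p : ℝ => (p ^ 2 + 1) ^ α) := by
  refine integrable_inv_one_add_sq.mono' ?_ (ae_of_all _ fun p => ?_)
  · exact (Continuous.rpow_const (by fun_prop)
      fun p => Or.inl (by positivity)).aestronglyMeasurable
  · rw [Real.norm_of_nonneg (by positivity), add_comm, ← Real.rpow_neg_one]
    exact Real.rpow_le_rpow_of_exponent_le (by nlinarith [sq_nonneg p]) hα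

lemma hasDerivAt_sq_add_one_rpow (α p : ℝ) :
    HasDerivAt (fun p : ℝ => (p ^ 2 + 1) ^ α) (2 * p * α * (p ^ 2 + 1) ^ (α - 1)) p := by
  have h : HasDerivAt (fun p : ℝ => p ^ 2 + 1) (2 * p) p := by
    simpa using (hasDerivAt_pow 2 p).add_const 1
  exact h.rpow_const (Or.inl (by positivity))

lemma integrable_deriv_sq_add_one_rpow {α : ℝ} (hα : α ≤ -1) :
    Integrable (fun p : ℝ => 2 * p * α * (p ^ 2 + 1) ^ (α - 1)) := by
  refine ((integrable_sq_add_one_rpow hα).const_mul |α|).mono' ?_ (ae_of_all _ fun p => ?_)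
  · have : Continuous (fun p : ℝ => (p ^ 2 + 1) ^ (α - 1)) :=
      Continuous.rpow_const (by fun_prop) fun p => Or.inl (by positivity)
    exact Continuous.aestronglyMeasurable (by fun_prop)
  · have hp : 0 < p ^ 2 + 1 := by positivity
    have h2 : |2 * p| ≤ p ^ 2 + 1 := abs_le.2 ⟨by nlinarith [sq_nonneg (p + 1)],
      by nlinarith [sq_nonneg (p - 1)]⟩
    have hpow : (p ^ 2 + 1) ^ α = (p ^ 2 + 1) * (p ^ 2 + 1) ^ (α - 1) := by
      rw [Real.rpow_sub_one hp.ne']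
      field_simp
    rw [Real.norm_eq_abs, abs_mul, abs_mul, abs_of_nonneg (Real.rpow_nonneg hp.le (α - 1)), hpow]
    calc |2 * p| * |α| * (p ^ 2 + 1) ^ (α - 1)
        ≤ (p ^ 2 + 1) * |α| * (p ^ 2 + 1) ^ (α - 1) := by gcongr
      _ = _ := by ring

/-- An integrable function stays integrable after multiplication by a continuous function with
values in `[-1, 1]`. -/
lemma MeasureTheory.Integrable.mul_of_abs_le_one {f g : ℝ → ℝ} (hf : Integrable f)
    (hg : Continuous g) (hb : ∀ x, |g x| ≤ 1) : Integrable (fun x => f x * g x) :=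
  hf.mul_bdd (c := 1) hg.aestronglyMeasurable (ae_of_all _ hb)

lemma abs_integral_mul_le_of_abs_le_one {f g : ℝ → ℝ} (hf : Integrable f)
    (hb : ∀ x, |g x| ≤ 1) : |∫ x, f x * g x| ≤ ∫ x, |f x| := by
  rw [← Real.norm_eq_abs]
  refine norm_integral_le_of_norm_le hf.abs (ae_of_all _ fun x => ?_)
  rw [Real.norm_eq_abs, abs_mul]
  exact mul_le_of_le_one_right (abs_nonneg _) (hb x)

/-- Integration by parts for the cosine transform. -/
lemma mul_integral_mul_cos_eq {f f' : ℝ → ℝ} (hd : ∀ p, HasDerivAt f (f' p) p)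
    (hf : Integrable f) (hf' : Integrable f') (u : ℝ) :
    u * ∫ p, f p * Real.cos (p * u) = -∫ p, f' p * Real.sin (p * u) := by
  have hs : ∀ p, HasDerivAt (fun p => Real.sin (p * u)) (Real.cos (p * u) * u) p := fun p => by
    simpa using ((hasDerivAt_id p).mul_const u).sin
  have hsin := fun {g : ℝ → ℝ} (hg : Integrable g) =>
    hg.mul_of_abs_le_one (g := fun p => Real.sin (p * u)) (by fun_prop)
      fun p => Real.abs_sin_le_one _
  have hcos := hf.mul_of_abs_le_one (g := fun p => Real.cos (p * u)) (by fun_prop)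
      fun p => Real.abs_cos_le_one _
  rw [← integral_mul_deriv_eq_deriv_mul_of_integrable (fun p _ => hd p) (fun p _ => hs p)
    (by simpa [Pi.mul_def, mul_assoc] using hcos.mul_const u) (hsin hf') (hsin hf),
    ← integral_const_mul]
  congr 1 with p
  ring

/-- The cosine transform of an integrable function with integrable derivative is
square integrable. -/
lemma integrable_sq_integral_mul_cos {f f' : ℝ → ℝ} (hd : ∀ p, HasDerivAt f (f' p) p)
    (hf : Integrable f) (hf' : Integrable f') :
    Integrable (fun u : ℝ => (∫ p, f p * Real.cos (p * u)) ^ 2) := by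
  have hcont : Continuous (fun u : ℝ => ∫ p, f p * Real.cos (p * u)) := by
    refine continuous_of_dominated (bound := fun p => |f p|) (fun u => ?_)
      (fun u => ae_of_all _ fun p => ?_) hf.abs (ae_of_all _ fun p => by fun_prop)
    · exact (hf.mul_of_abs_le_one (g := fun p => Real.cos (p * u)) (by fun_prop)
        fun p => Real.abs_cos_le_one _).aestronglyMeasurable
    · rw [Real.norm_eq_abs, abs_mul]
      exact mul_le_of_le_one_right (abs_nonneg _) (Real.abs_cos_le_one _)
  refine (integrable_inv_one_add_sq.const_mul ((∫ p, |f p|) ^ 2 + (∫ p, |f' p|) ^ 2)).mono'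
    (hcont.pow 2).aestronglyMeasurable (ae_of_all _ fun u => ?_)
  have h0 := sq_le_sq.2 ((abs_integral_mul_le_of_abs_le_one hf
    fun p => Real.abs_cos_le_one (p * u)).trans (le_abs_self _))
  have h1 := sq_le_sq.2 ((abs_integral_mul_le_of_abs_le_one hf'
    fun p => Real.abs_sin_le_one (p * u)).trans (le_abs_self _))
  rw [← neg_sq, ← mul_integral_mul_cos_eq hd hf hf' u, mul_pow] at h1
  rw [Real.norm_of_nonneg (sq_nonneg _), ← div_eq_mul_inv, le_div_iff₀ (by positivity)]
  linarith

/-- For `α ≤ −1`, `F(u) = ∫ (p²+1)^α cos(pu) dp` and `X(r) = r^α F(r)`: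
`c = ∫ F² < ∞` and for all `λ, ρ > 0`,
`∫_ρ^∞ X(r√λ)² r² dr ≤ c ρ^{2α+2} λ^{α−1/2}`. -/
theorem tail_L2_estimate
    (α : ℝ) (hα : α ≤ -1)
    (F : ℝ → ℝ) (hF : ∀ u, F u = ∫ p : ℝ, (p ^ 2 + 1) ^ α * Real.cos (p * u))
    (X : ℝ → ℝ) (hX : ∀ r, 0 < r → X r = r ^ α * F r) :
    Integrable (fun u : ℝ => F u ^ 2) ∧
    ∀ lam > (0:ℝ), ∀ ρ > (0:ℝ),
      (∫ r in Set.Ioi ρ, X (r * Real.sqrt lam) ^ 2 * r ^ 2) ≤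
        (∫ u : ℝ, F u ^ 2) * ρ ^ (2 * α + 2) * lam ^ (α - 1/2) := by
  have hint : Integrable (fun u : ℝ => F u ^ 2) := by
    simpa only [← hF] using integrable_sq_integral_mul_cos (hasDerivAt_sq_add_one_rpow α)
      (integrable_sq_add_one_rpow hα) (integrable_deriv_sq_add_one_rpow hα)
  refine ⟨hint, fun lam hlam ρ hρ => ?_⟩
  have hs : 0 < √lam := Real.sqrt_pos.2 hlam
  have hscaled : Integrable (fun r : ℝ => ρ ^ (2 * α + 2) * lam ^ α * F (r * √lam) ^ 2) :=
    (hint.comp_mul_right' hs.ne').const_mul _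
  have hpoint : ∀ r ∈ Set.Ioi ρ, X (r * √lam) ^ 2 * r ^ 2 ≤
      ρ ^ (2 * α + 2) * lam ^ α * F (r * √lam) ^ 2 := by
    intro r hr
    have hr0 : 0 < r := hρ.trans hr
    have hlam2 : ((√lam) ^ α) ^ 2 = lam ^ α := by
      rw [← Real.rpow_mul_natCast hs.le, mul_comm, Real.rpow_mul hs.le]
      simp [Real.sq_sqrt hlam.le]
    have hr2 : (r ^ α) ^ 2 * r ^ 2 = r ^ (2 * α + 2) := by
      rw [Real.rpow_add hr0, mul_comm 2 α, Real.rpow_mul hr0.le]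
      simp
    have hmono : r ^ (2 * α + 2) ≤ ρ ^ (2 * α + 2) :=
      Real.rpow_le_rpow_of_nonpos hρ hr.le (by linarith)
    rw [hX _ (by positivity), Real.mul_rpow hr0.le hs.le]
    calc (r ^ α * √lam ^ α * F (r * √lam)) ^ 2 * r ^ 2
        = ((r ^ α) ^ 2 * r ^ 2) * (√lam ^ α) ^ 2 * F (r * √lam) ^ 2 := by ring
      _ ≤ _ := by rw [hr2, hlam2]; gcongr
  calc ∫ r in Set.Ioi ρ, X (r * √lam) ^ 2 * r ^ 2
      ≤ ∫ r in Set.Ioi ρ, ρ ^ (2 * α + 2) * lam ^ α * F (r * √lam) ^ 2 :=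
        integral_mono_of_nonneg (ae_of_all _ fun r => by positivity) hscaled.integrableOn
          ((ae_restrict_mem measurableSet_Ioi).mono hpoint)
    _ ≤ ∫ r, ρ ^ (2 * α + 2) * lam ^ α * F (r * √lam) ^ 2 :=
        setIntegral_le_integral hscaled (ae_of_all _ fun r => by positivity)
    _ = (∫ u : ℝ, F u ^ 2) * ρ ^ (2 * α + 2) * lam ^ (α - 1/2) := by
        rw [integral_const_mul, Measure.integral_comp_mul_right (fun u => F u ^ 2),
          abs_of_pos (inv_pos.2 hs), Real.rpow_sub hlam, ← Real.sqrt_eq_rpow, smul_eq_mul]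
        ring
end

section
/- There exist a constant C > 0 and functions g, T : [1, ∞) → ℝ such that: g is twice continuously differentiable; T is continuous; g''(t) + T(t) g(t) = 0 for all t ≥ 1; |T(t)| ≤ C t^{−2} for all t ≥ 1; g(4t) = g(t) for all t ≥ 1; and the zero set {t ∈ [1, ∞) : g(t) = 0} is infinite. -/
/-- A periodic profile whose second derivative minus its first derivative is a bounded continuous
multiple of itself. -/
noncomputable def profile (ω s : ℝ) : ℝ :=
  Real.exp (Real.sin (2 * (ω * s)) / (4 * ω)) * Real.sin (ω * s)

/-- The derivative of `profile ω`. -/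
noncomputable def profileDeriv (ω s : ℝ) : ℝ :=
  Real.exp (Real.sin (2 * (ω * s)) / (4 * ω)) *
    (Real.cos (2 * (ω * s)) / 2 * Real.sin (ω * s) + ω * Real.cos (ω * s))

/-- The ratio `(h'' - h') / h` for `h = profile ω`. -/
noncomputable def profileRatio (ω s : ℝ) : ℝ :=
  Real.cos (2 * (ω * s)) ^ 2 / 4 - Real.cos (2 * (ω * s)) / 2 - ω ^ 2
    - 2 * ω * Real.sin (2 * (ω * s))

lemma hasDerivAt_exp_sin_div {ω : ℝ} (hω : ω ≠ 0) (s : ℝ) :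
    HasDerivAt (fun s => Real.exp (Real.sin (2 * (ω * s)) / (4 * ω)))
      (Real.exp (Real.sin (2 * (ω * s)) / (4 * ω)) * (Real.cos (2 * (ω * s)) / 2)) s := by
  have hb : HasDerivAt (fun s : ℝ => ω * s) ω s := by
    simpa using (hasDerivAt_id s).const_mul ω
  convert ((hb.const_mul 2).sin.div_const (4 * ω)).exp using 1
  field_simp
  ring

lemma hasDerivAt_profile {ω : ℝ} (hω : ω ≠ 0) (s : ℝ) :
    HasDerivAt (profile ω) (profileDeriv ω s) s := by
  have hb : HasDerivAt (fun s : ℝ => ω * s) ω s := by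
    simpa using (hasDerivAt_id s).const_mul ω
  have h : HasDerivAt (profile ω) _ s := (hasDerivAt_exp_sin_div hω s).mul hb.sin
  refine h.congr_deriv ?_
  simp only [profileDeriv]
  ring

lemma hasDerivAt_profileDeriv {ω : ℝ} (hω : ω ≠ 0) (s : ℝ) :
    HasDerivAt (profileDeriv ω) (profileDeriv ω s + profileRatio ω s * profile ω s) s := by
  have hb : HasDerivAt (fun s : ℝ => ω * s) ω s := by
    simpa using (hasDerivAt_id s).const_mul ω
  have h : HasDerivAt (profileDeriv ω) _ s := (hasDerivAt_exp_sin_div hω s).mul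
    ((((hb.const_mul 2).cos.div_const 2).mul hb.sin).add (hb.cos.const_mul ω))
  refine h.congr_deriv ?_
  simp only [profileDeriv, profileRatio, profile]
  generalize Real.exp _ = E
  have hc : Real.cos (2 * (ω * s)) = 1 - 2 * Real.sin (ω * s) ^ 2 := by
    rw [Real.cos_two_mul, Real.cos_sq']; ring
  rw [hc, Real.sin_two_mul]
  ring

lemma profile_add_period {ω p : ℝ} (hp : ω * p = 2 * Real.pi) (s : ℝ) :
    profile ω (p + s) = profile ω s := by
  have h₁ : ω * (p + s) = ω * s + 2 * Real.pi := by rw [← hp]; ring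
  have h₂ : 2 * (ω * s + 2 * Real.pi) = 2 * (ω * s) + 2 * Real.pi + 2 * Real.pi := by ring
  simp only [profile, h₁, h₂, Real.sin_add_two_pi]

lemma continuous_profile (ω : ℝ) : Continuous (profile ω) := by
  unfold profile
  fun_prop

lemma continuous_profileRatio (ω : ℝ) : Continuous (profileRatio ω) := by
  unfold profileRatio
  fun_prop

lemma abs_profileRatio_le {ω : ℝ} (hω : 0 < ω) (s : ℝ) :
    |profileRatio ω s| ≤ 1 + ω ^ 2 + 2 * ω := by
  have hc₁ := Real.cos_le_one (2 * (ω * s))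
  have hc₂ := Real.neg_one_le_cos (2 * (ω * s))
  have hs₁ := mul_le_mul_of_nonneg_left (Real.sin_le_one (2 * (ω * s))) hω.le
  have hs₂ := mul_le_mul_of_nonneg_left (Real.neg_one_le_sin (2 * (ω * s))) hω.le
  unfold profileRatio
  rw [abs_le]
  constructor <;> nlinarith [sq_nonneg ω]


/-- There exist `C > 0` and functions `g, T` on `[1, ∞)` with `g` twice continuously
differentiable, `T` continuous, `g'' + T g = 0`, `|T(t)| ≤ C t^{−2}`, `g(4t) = g(t)`, and
`g` having infinitely many zeros. -/
theorem sharp_decay_example :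
    ∃ C : ℝ, 0 < C ∧ ∃ g T g' g'' : ℝ → ℝ,
      (∀ t ∈ Set.Ici (1:ℝ), HasDerivWithinAt g (g' t) (Set.Ici 1) t ∧
        HasDerivWithinAt g' (g'' t) (Set.Ici 1) t) ∧
      ContinuousOn g'' (Set.Ici 1) ∧
      ContinuousOn T (Set.Ici 1) ∧
      (∀ t ∈ Set.Ici (1:ℝ), g'' t + T t * g t = 0) ∧
      (∀ t ∈ Set.Ici (1:ℝ), |T t| ≤ C / t ^ 2) ∧
      (∀ t ∈ Set.Ici (1:ℝ), g (4 * t) = g t) ∧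
      {t ∈ Set.Ici (1:ℝ) | g t = 0}.Infinite := by
  have hlog : 0 < Real.log 4 := Real.log_pos (by norm_num)
  obtain ⟨ω, hω, hp⟩ : ∃ ω : ℝ, 0 < ω ∧ ω * Real.log 4 = 2 * Real.pi :=
    ⟨2 * Real.pi / Real.log 4, by positivity, div_mul_cancel₀ _ hlog.ne'⟩
  have hpos : ∀ t ∈ Set.Ici (1 : ℝ), t ≠ 0 := fun t ht =>
    (lt_of_lt_of_le one_pos ht).ne'
  have hlogc : ContinuousOn Real.log (Set.Ici 1) := Real.continuousOn_log.mono hpos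
  have hT : ContinuousOn (fun t => -(profileRatio ω (Real.log t) / t ^ 2)) (Set.Ici 1) :=
    (((continuous_profileRatio ω).comp_continuousOn hlogc).div (by fun_prop)
      fun t ht => pow_ne_zero 2 (hpos t ht)).neg
  refine ⟨1 + ω ^ 2 + 2 * ω, by positivity, fun t => profile ω (Real.log t),
    fun t => -(profileRatio ω (Real.log t) / t ^ 2),
    fun t => profileDeriv ω (Real.log t) / t,
    fun t => profileRatio ω (Real.log t) / t ^ 2 * profile ω (Real.log t),
    fun t ht => ⟨?_, ?_⟩, ?_, hT, fun t ht => by ring, fun t ht => ?_, fun t ht => ?_, ?_⟩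
  · exact ((hasDerivAt_profile hω.ne' _).comp t
      (Real.hasDerivAt_log (hpos t ht))).hasDerivWithinAt
  · have h := ((hasDerivAt_profileDeriv hω.ne' _).comp t
      (Real.hasDerivAt_log (hpos t ht))).div (hasDerivAt_id t) (hpos t ht)
    refine HasDerivAt.hasDerivWithinAt (h.congr_deriv ?_)
    have := hpos t ht
    simp only [Function.comp_apply, id_eq]
    field_simp
    ring
  · refine (hT.neg.mul ((continuous_profile ω).comp_continuousOn hlogc)).congr fun t _ => ?_
    simp
  · rw [abs_neg, abs_div, abs_of_nonneg (sq_nonneg t)]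
    exact div_le_div_of_nonneg_right (abs_profileRatio_le hω _) (sq_nonneg t)
  · simp only [Real.log_mul four_ne_zero (hpos t ht), profile_add_period hp]
  · refine Set.infinite_of_injective_forall_mem (f := fun n : ℕ => (4 : ℝ) ^ n)
      (pow_right_injective₀ (by norm_num) (by norm_num)) fun n => ⟨?_, ?_⟩
    · exact one_le_pow₀ (by norm_num : (1 : ℝ) ≤ 4)
    · have h : ω * (n * Real.log 4) = (2 * n : ℕ) * Real.pi := by
        push_cast
        linear_combination n * hp
      simp only [profile, Real.log_pow, h, Real.sin_nat_mul_pi, mul_zero]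
end
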